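/- Let a, b, x be complex numbers with (a−2) + m ≠ 0 for every natural number m. Define, for each natural number k, S(k) = ∑_{j=0}^{2k} [(a)_j (a+b)_j x^j / ((a−2)_j · j!)] · [(a)_{2k−j} (a+b)_{2k−j} (−x)^{2k−j} / ((a−2)_{2k−j} · (2k−j)!)]. Then for every natural number k, −(k+1) · (−7ak² + 5k²b + k²b² + a²k² + 8k² − 2abk² + 21ak + 4abk − 12k − 2ka²b − 13a²k + 2ka³ − 5kb − kb² + 4 − 12a + a⁴ − 6a³ + 13a²) · S(k+1) + (a+b+k) · (a⁴ − 4a³ + 2ka³ − 11a²k + a²k² − 2a²b + a² − 2ka²b + 2a − 7ak² + 7ak + 2ab − 2abk² + 8k² + 5kb + k²b² + kb² + 5k²b + 4k) · x² · S(k) = 0. -/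

import Mathlib

/-- Rising factorial (Pochhammer symbol) `(z)_n` over the complex numbers. -/
noncomputable def poch (z : ℂ) (n : ℕ) : ℂ := (ascPochhammer ℂ n).eval z

lemma poch_zero (z : ℂ) : poch z 0 = 1 := by simp [poch]

lemma poch_succ (z : ℂ) (n : ℕ) : poch z (n + 1) = poch z n * (z + n) :=
  ascPochhammer_succ_eval n z

lemma poch_succ_left (z : ℂ) (n : ℕ) : poch z (n + 1) = z * poch (z + 1) n := by
  simp [poch, ascPochhammer_succ_left, Polynomial.eval_comp]

lemma poch_add_two_left (z : ℂ) (n : ℕ) :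
    poch z (n + 2) = z * (z + 1) * poch (z + 2) n := by
  rw [poch_succ_left, poch_succ_left, ← mul_assoc]
  norm_num [add_assoc]

lemma poch_ne_zero {z : ℂ} (hz : ∀ m : ℕ, z + (m : ℂ) ≠ 0) (n : ℕ) : poch z n ≠ 0 := by
  induction n with
  | zero => simp [poch_zero]
  | succ n ih => rw [poch_succ]; exact mul_ne_zero ih (hz n)

lemma mul_poch_eq_mul_poch_sub_two (a : ℂ) (n : ℕ) :
    (a - 2) * (a - 1) * poch a n = (a - 2 + n) * (a - 1 + n) * poch (a - 2) n := by
  have h1 := poch_add_two_left (a - 2) n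
  rw [poch_succ, poch_succ, sub_add_cancel] at h1
  push_cast at h1
  linear_combination -h1

/-- The power series of `(1 - s X) ^ (-d)`. -/
noncomputable def negBinomial (d s : ℂ) : PowerSeries ℂ :=
  PowerSeries.mk fun n => poch d n / (n.factorial : ℂ) * s ^ n

open PowerSeries in
lemma negBinomial_deriv (d s : ℂ) :
    (1 - C s * X) * derivative ℂ (negBinomial d s) = C (d * s) * negBinomial d s := by
  ext n
  have hn : ((n : ℂ) + 1) ≠ 0 := Nat.cast_add_one_ne_zero n
  have hf : (n.factorial : ℂ) ≠ 0 := Nat.cast_ne_zero.2 n.factorial_ne_zero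
  rw [sub_mul, one_mul, mul_assoc, map_sub, coeff_C_mul, coeff_C_mul]
  cases n with
  | zero =>
    simp [negBinomial, coeff_derivative, poch_succ, poch_zero]
  | succ m =>
    have hm : ((m : ℂ) + 1) ≠ 0 := Nat.cast_add_one_ne_zero m
    have hg : (m.factorial : ℂ) ≠ 0 := Nat.cast_ne_zero.2 m.factorial_ne_zero
    simp only [coeff_succ_X_mul, coeff_derivative, negBinomial, coeff_mk, poch_succ,
      Nat.factorial_succ] at *
    push_cast at *
    field_simp
    ring

open PowerSeries in
/-- `(1 - s X) ^ (-d) * (1 + s X) ^ (-d) = (1 - s ^ 2 X ^ 2) ^ (-d)`, in even degrees. -/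
lemma coeff_negBinomial_mul (d s : ℂ) (k : ℕ) :
    coeff (2 * k) (negBinomial d s * negBinomial d (-s)) =
      poch d k / (k.factorial : ℂ) * s ^ (2 * k) := by
  have h : (1 - C (s ^ 2) * X ^ 2) * derivative ℂ (negBinomial d s * negBinomial d (-s)) =
      C (2 * d * s ^ 2) * (X * (negBinomial d s * negBinomial d (-s))) := by
    have h1 := negBinomial_deriv d s
    have h2 := negBinomial_deriv d (-s)
    rw [Derivation.leibniz, smul_eq_mul, smul_eq_mul]
    simp only [map_neg, map_mul, map_pow, mul_neg, map_ofNat] at h1 h2 ⊢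
    linear_combination (1 + C s * X) * negBinomial d (-s) * h1 +
      (1 - C s * X) * negBinomial d s * h2
  induction k with
  | zero =>
    simp [negBinomial, poch_zero]
  | succ k ih =>
    have hk : ((k : ℂ) + 1) ≠ 0 := Nat.cast_add_one_ne_zero k
    have hf : (k.factorial : ℂ) ≠ 0 := Nat.cast_ne_zero.2 k.factorial_ne_zero
    generalize negBinomial d s * negBinomial d (-s) = H at *
    have h3 := congrArg (coeff (2 * k + 1)) h
    rw [sub_mul, one_mul, mul_assoc, map_sub, coeff_C_mul, coeff_C_mul, coeff_succ_X_mul,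
      coeff_derivative, ih] at h3
    have h4 : coeff (2 * k + 1) (X ^ 2 * derivative ℂ H) = coeff (2 * k) H * (2 * k) := by
      rw [pow_two, mul_assoc, coeff_succ_X_mul]
      cases k with
      | zero => simp
      | succ m =>
        rw [show 2 * (m + 1) = (2 * m + 1) + 1 by ring, coeff_succ_X_mul, coeff_derivative]
        push_cast
        ring
    rw [h4, ih] at h3
    rw [show 2 * (k + 1) = 2 * k + 1 + 1 by ring, poch_succ, Nat.factorial_succ]
    push_cast at h3 ⊢
    have h5 : ((k : ℂ) + 1) * coeff (2 * k + 1 + 1) H =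
        (d + k) * (poch d k / (k.factorial : ℂ) * s ^ (2 * k)) * s ^ 2 := by
      linear_combination h3 / 2
    have h6 : coeff (2 * k + 1 + 1) H =
        (d + k) * (poch d k / (k.factorial : ℂ) * s ^ (2 * k)) * s ^ 2 / ((k : ℂ) + 1) := by
      rw [eq_div_iff hk, ← h5]; ring
    rw [h6]
    field_simp
    ring

/-- The series with coefficients `(a - 2 + n) (a - 1 + n) (c)_n / n! * s ^ n`, a multiple of
`₂F₁(a, c; a - 2; s X)`. -/
noncomputable def hyperSeries (a c s : ℂ) : PowerSeries ℂ :=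
  PowerSeries.mk fun n =>
    (a - 2 + n) * (a - 1 + n) * poch c n / (n.factorial : ℂ) * s ^ n

open PowerSeries in
lemma hyperSeries_eq (a c s : ℂ) :
    hyperSeries a c s =
      (C ((a - 1) * (a - 2)) + C ((2 * (a - 1) * c - 2 * ((a - 1) * (a - 2))) * s) * X
        + C (((a - 1) * (a - 2) - 2 * (a - 1) * c + c * (c + 1)) * s ^ 2) * X ^ 2) *
      negBinomial (c + 2) s := by
  ext n
  rw [add_mul, add_mul, mul_assoc (C _) X, mul_assoc (C _) (X ^ 2), map_add, map_add,
    coeff_C_mul, coeff_C_mul, coeff_C_mul]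
  match n with
  | 0 =>
    simp [hyperSeries, negBinomial, poch_zero]
    ring
  | 1 =>
    rw [pow_two X, mul_assoc X, coeff_succ_X_mul 0 (negBinomial (c + 2) s),
      coeff_succ_X_mul 0 (X * negBinomial (c + 2) s)]
    simp [hyperSeries, negBinomial, poch_zero, poch_succ]
    ring
  | m + 2 =>
    have hm : ((m : ℂ) + 1) ≠ 0 := Nat.cast_add_one_ne_zero m
    have hm2 : ((m : ℂ) + 1 + 1) ≠ 0 := by exact_mod_cast Nat.succ_ne_zero (m + 1)
    have hg : (m.factorial : ℂ) ≠ 0 := Nat.cast_ne_zero.2 m.factorial_ne_zero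
    rw [pow_two X, mul_assoc X, coeff_succ_X_mul, coeff_succ_X_mul, coeff_succ_X_mul]
    simp only [hyperSeries, negBinomial, coeff_mk]
    rw [poch_add_two_left c, poch_succ _ (m + 1), poch_succ _ m, Nat.factorial_succ,
      Nat.factorial_succ]
    push_cast
    field_simp
    ring

open PowerSeries in
lemma coeff_hyperSeries_mul (a b s : ℂ) (k : ℕ) :
    coeff (2 * k) (hyperSeries a (a + b) s * hyperSeries a (a + b) (-s)) =
      s ^ (2 * k) * poch (a + b) k / (k.factorial : ℂ) *
      (-7 * a * (k : ℂ) ^ 2 + 5 * (k : ℂ) ^ 2 * b + (k : ℂ) ^ 2 * b ^ 2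
            + a ^ 2 * (k : ℂ) ^ 2 + 8 * (k : ℂ) ^ 2 - 2 * a * b * (k : ℂ) ^ 2
            + 21 * a * (k : ℂ) + 4 * a * b * (k : ℂ) - 12 * (k : ℂ)
            - 2 * (k : ℂ) * a ^ 2 * b - 13 * a ^ 2 * (k : ℂ) + 2 * (k : ℂ) * a ^ 3
            - 5 * (k : ℂ) * b - (k : ℂ) * b ^ 2 + 4 - 12 * a + a ^ 4 - 6 * a ^ 3
            + 13 * a ^ 2) := by
  obtain ⟨p, hp⟩ : ∃ p, p = (a - 1) * (a - 2) := ⟨_, rfl⟩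
  obtain ⟨q, hq⟩ : ∃ q, q = 2 * (a - 1) * (a + b) - 2 * ((a - 1) * (a - 2)) := ⟨_, rfl⟩
  obtain ⟨r, hr⟩ : ∃ r, r = (a - 1) * (a - 2) - 2 * (a - 1) * (a + b)
    + (a + b) * (a + b + 1) := ⟨_, rfl⟩
  have h : hyperSeries a (a + b) s * hyperSeries a (a + b) (-s) =
      C (p ^ 2) * (negBinomial (a + b + 2) s * negBinomial (a + b + 2) (-s))
      + C ((2 * p * r - q ^ 2) * s ^ 2) *
        (X ^ 2 * (negBinomial (a + b + 2) s * negBinomial (a + b + 2) (-s)))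
      + C (r ^ 2 * s ^ 4) *
        (X ^ 2 * (X ^ 2 * (negBinomial (a + b + 2) s * negBinomial (a + b + 2) (-s)))) := by
    rw [hyperSeries_eq, hyperSeries_eq, ← hq, ← hr, ← hp]
    simp only [map_neg, map_mul, map_pow, map_sub, mul_neg, map_ofNat]
    ring
  have key := coeff_negBinomial_mul (a + b + 2) s
  rw [h, map_add, map_add, coeff_C_mul, coeff_C_mul, coeff_C_mul]
  generalize negBinomial (a + b + 2) s * negBinomial (a + b + 2) (-s) = H at key
  have hX : ∀ (j : ℕ) (G : PowerSeries ℂ), coeff (2 * (j + 1)) (X ^ 2 * G) = coeff (2 * j) G := by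
    intro j G
    rw [show 2 * (j + 1) = 2 * j + 2 by ring, coeff_X_pow_mul]
  have hX0 : ∀ G : PowerSeries ℂ, coeff (2 * 0) (X ^ 2 * G) = 0 := by
    intro G
    simp
  match k with
  | 0 =>
    rw [hX0, hX0, key, hp]
    simp [poch_zero]
    ring
  | 1 =>
    rw [hX 0, hX 0, hX0, key, key 0, hp, hq, hr]
    simp [poch_zero, poch_succ]
    ring
  | m + 2 =>
    have hm : ((m : ℂ) + 1) ≠ 0 := Nat.cast_add_one_ne_zero m
    have hm2 : ((m : ℂ) + 1 + 1) ≠ 0 := by exact_mod_cast Nat.succ_ne_zero (m + 1)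
    have hg : (m.factorial : ℂ) ≠ 0 := Nat.cast_ne_zero.2 m.factorial_ne_zero
    rw [hX (m + 1), hX (m + 1), hX m, key, key, key, poch_add_two_left (a + b), poch_succ _ (m + 1),
      poch_succ _ m, Nat.factorial_succ, Nat.factorial_succ, hp, hq, hr]
    push_cast
    field_simp
    ring

theorem stmt_15 (a b x : ℂ) (ha : ∀ m : ℕ, a - 2 + (m : ℂ) ≠ 0)
    (S : ℕ → ℂ)
    (hS : ∀ k : ℕ, S k = ∑ j ∈ Finset.range (2 * k + 1),
      (poch a j * poch (a + b) j * x ^ j / (poch (a - 2) j * (j.factorial : ℂ))) *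
        (poch a (2 * k - j) * poch (a + b) (2 * k - j) * (-x) ^ (2 * k - j) /
          (poch (a - 2) (2 * k - j) * ((2 * k - j).factorial : ℂ)))) :
    ∀ k : ℕ,
      -(((k : ℂ) + 1) *
          (-7 * a * (k : ℂ) ^ 2 + 5 * (k : ℂ) ^ 2 * b + (k : ℂ) ^ 2 * b ^ 2
            + a ^ 2 * (k : ℂ) ^ 2 + 8 * (k : ℂ) ^ 2 - 2 * a * b * (k : ℂ) ^ 2
            + 21 * a * (k : ℂ) + 4 * a * b * (k : ℂ) - 12 * (k : ℂ)
            - 2 * (k : ℂ) * a ^ 2 * b - 13 * a ^ 2 * (k : ℂ) + 2 * (k : ℂ) * a ^ 3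
            - 5 * (k : ℂ) * b - (k : ℂ) * b ^ 2 + 4 - 12 * a + a ^ 4 - 6 * a ^ 3
            + 13 * a ^ 2)) * S (k + 1)
      + (a + b + (k : ℂ)) *
          (a ^ 4 - 4 * a ^ 3 + 2 * (k : ℂ) * a ^ 3 - 11 * a ^ 2 * (k : ℂ)
            + a ^ 2 * (k : ℂ) ^ 2 - 2 * a ^ 2 * b + a ^ 2 - 2 * (k : ℂ) * a ^ 2 * b
            + 2 * a - 7 * a * (k : ℂ) ^ 2 + 7 * a * (k : ℂ) + 2 * a * b
            - 2 * a * b * (k : ℂ) ^ 2 + 8 * (k : ℂ) ^ 2 + 5 * (k : ℂ) * b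
            + (k : ℂ) ^ 2 * b ^ 2 + (k : ℂ) * b ^ 2 + 5 * (k : ℂ) ^ 2 * b
            + 4 * (k : ℂ)) * x ^ 2 * S k = 0 := by
  intro k
  have h1 : a - 1 ≠ 0 := by
    have := ha 1
    push_cast at this
    intro h
    exact this (by linear_combination h)
  have h2 : a - 2 ≠ 0 := by simpa using ha 0
  have hterm : ∀ (s : ℂ) (n : ℕ),
      poch a n * poch (a + b) n * s ^ n / (poch (a - 2) n * (n.factorial : ℂ)) =
        PowerSeries.coeff n (hyperSeries a (a + b) s) / ((a - 2) * (a - 1)) := by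
    intro s n
    have hf : (n.factorial : ℂ) ≠ 0 := Nat.cast_ne_zero.2 n.factorial_ne_zero
    have hp := poch_ne_zero ha n
    have h := mul_poch_eq_mul_poch_sub_two a n
    rw [hyperSeries, PowerSeries.coeff_mk, div_eq_div_iff (mul_ne_zero hp hf)
      (mul_ne_zero h2 h1)]
    field_simp
    linear_combination s ^ n * poch (a + b) n * h
  have hclosed : ∀ n : ℕ, S n = PowerSeries.coeff (2 * n)
      (hyperSeries a (a + b) x * hyperSeries a (a + b) (-x)) / ((a - 2) * (a - 1)) ^ 2 := by
    intro n
    rw [hS, PowerSeries.coeff_mul, Finset.Nat.sum_antidiagonal_eq_sum_range_succ_mk,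
      Finset.sum_div]
    refine Finset.sum_congr rfl fun j _ => ?_
    rw [hterm, hterm, div_mul_div_comm, pow_two]
  have hk : ((k : ℂ) + 1) ≠ 0 := Nat.cast_add_one_ne_zero k
  have hf : (k.factorial : ℂ) ≠ 0 := Nat.cast_ne_zero.2 k.factorial_ne_zero
  rw [hclosed, hclosed, coeff_hyperSeries_mul, coeff_hyperSeries_mul, poch_succ,
    Nat.factorial_succ]
  push_cast
  field_simp
  ring
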